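/- Suppose a finite legal sequence of Engel moves starts and ends at the same configuration on the transient states, and let v ≥ 1 be the number of type-2 moves performed, w_j = r_j × (number of type-1 moves performed at transient state j), and v_k = Σ_{j transient} (number of type-1 moves at j) × r_{jk} the number of chips deposited into absorbing state k. Then, writing p_{ji} = r_{ji}/r_j, the following conservation equations hold: w_u = v + Σ_{j transient} w_j · p_{ju}; w_i = Σ_{j transient} w_j · p_{ji} for every transient i ≠ u; v_k = Σ_{j transient} w_j · p_{jk} for every absorbing k; and v = Σ_{k absorbing} v_k. -/

import Mathlib

/-- A move in Engel's chip game: a type-1 move fires the transient state `i`,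
a type-2 move adds a single chip at the distinguished starting state. -/
inductive EngelMove (s : ℕ) where
  | type1 (i : Fin s) : EngelMove s
  | type2 : EngelMove s
deriving DecidableEq

/-- The effect of a move on a configuration of chips: a type-1 move at `i` removes
`ri i` chips from `i` and sends `rij i j` chips to each state `j`; a type-2 move adds
one chip at the distinguished state `u`. -/
def engelApply {s : ℕ} (u : Fin s) (ri : Fin s → ℕ) (rij : Fin s → Fin s → ℕ) :
    EngelMove s → (Fin s → ℕ) → (Fin s → ℕ)
  | .type1 i, c => fun j => c j - (if j = i then ri i else 0) + rij i j
  | .type2, c => fun j => c j + (if j = u then 1 else 0)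

/-- Legality of a move in a configuration (`r` = number of transient states):
a type-1 move at `i` is legal iff `i` is transient and carries at least `ri i` chips;
type-2 moves are always allowed. -/
def engelLegal {s : ℕ} (r : ℕ) (ri : Fin s → ℕ) :
    EngelMove s → (Fin s → ℕ) → Prop
  | .type1 i, c => (i : ℕ) < r ∧ ri i ≤ c i
  | .type2, _ => True

/-- A list of moves is a legal sequence from a configuration if every type-1 move in it
is legal in the configuration at which it is performed. -/
def engelLegalSeq {s : ℕ} (r : ℕ) (u : Fin s) (ri : Fin s → ℕ)
    (rij : Fin s → Fin s → ℕ) : (Fin s → ℕ) → List (EngelMove s) → Prop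
  | _, [] => True
  | c, m :: ms => engelLegal r ri m c ∧
      engelLegalSeq r u ri rij (engelApply u ri rij m c) ms

/-- The configuration obtained after performing a list of moves. -/
def engelRun {s : ℕ} (u : Fin s) (ri : Fin s → ℕ) (rij : Fin s → Fin s → ℕ)
    (c : Fin s → ℕ) (ms : List (EngelMove s)) : Fin s → ℕ :=
  ms.foldl (fun c m => engelApply u ri rij m c) c

theorem engelRun_add_fired {s : ℕ} {r : ℕ} {u : Fin s} {ri : Fin s → ℕ}
    {rij : Fin s → Fin s → ℕ} {c : Fin s → ℕ} {ms : List (EngelMove s)}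
    (hlegal : engelLegalSeq r u ri rij c ms) (i : Fin s) :
    engelRun u ri rij c ms i + ri i * ms.count (.type1 i) =
      c i + (if i = u then ms.count .type2 else 0) +
        ∑ j ∈ Finset.univ.filter (fun j : Fin s => (j : ℕ) < r),
          ms.count (.type1 j) * rij j i := by
  induction ms generalizing c with
  | nil => simp [engelRun]
  | cons m ms ih =>
    obtain ⟨hm, hms⟩ := hlegal
    have h := ih hms
    have hrun : engelRun u ri rij c (m :: ms) =
      engelRun u ri rij (engelApply u ri rij m c) ms := rfl
    rw [hrun]
    cases m with
    | type1 a =>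
      obtain ⟨har, hac⟩ := hm
      have hcount (j : Fin s) : (EngelMove.type1 a :: ms).count (.type1 j) =
          ms.count (.type1 j) + if a = j then 1 else 0 := by
        simp [List.count_cons]
      have hcount₂ : (EngelMove.type1 a :: ms).count .type2 = ms.count .type2 := by
        simp
      simp only [hcount, hcount₂, add_mul, mul_add, Finset.sum_add_distrib, ite_mul, one_mul,
        zero_mul, Finset.sum_ite_eq, Finset.mem_filter, Finset.mem_univ, true_and, har, if_true]
      simp only [engelApply] at h ⊢
      by_cases hia : i = a
      · subst hia
        simp only [if_true, mul_one] at h ⊢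
        omega
      · simp only [hia, Ne.symm hia, if_false, mul_zero] at h ⊢
        omega
    | type2 =>
      have hcount (j : Fin s) : (EngelMove.type2 :: ms).count (.type1 j) =
          ms.count (.type1 j) := by
        simp
      have hcount₂ : (EngelMove.type2 :: ms).count (.type2 : EngelMove s) =
          ms.count .type2 + 1 := by
        simp
      simp only [hcount, hcount₂]
      simp only [engelApply] at h ⊢
      split_ifs at h ⊢ <;> omega

/-- If a finite legal sequence of Engel moves starts and ends at the
same configuration on the transient states, then with `v` the number of type-2 moves
(assumed `≥ 1`), `w j = rⱼ ·(number of type-1 moves at j)`, `v k` the number of chips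
deposited into the absorbing state `k`, and `p j i = r_{ji}/r_j`, the conservation
equations hold: `w u = v + ∑_j w j · p j u`; `w i = ∑_j w j · p j i` for transient
`i ≠ u`; `v k = ∑_j w j · p j k` for absorbing `k`; and `v = ∑_k v k`. -/
theorem engel_conservation_equations
    (r s : ℕ) (hr : 1 ≤ r) (hrs : r < s)
    (u : Fin s) (hu : (u : ℕ) < r)
    (ri : Fin s → ℕ) (hri : ∀ i : Fin s, (i : ℕ) < r → 0 < ri i)
    (rij : Fin s → Fin s → ℕ)
    (hsum : ∀ i : Fin s, (i : ℕ) < r → ∑ j, rij i j = ri i)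
    (c : Fin s → ℕ) (ms : List (EngelMove s))
    (hlegal : engelLegalSeq r u ri rij c ms)
    (hsame : ∀ i : Fin s, (i : ℕ) < r → engelRun u ri rij c ms i = c i)
    (hv1 : 1 ≤ ms.count EngelMove.type2)
    (v : ℚ) (hv : v = (ms.count EngelMove.type2 : ℚ))
    (w : Fin s → ℚ)
    (hw : ∀ j : Fin s, w j = (ri j : ℚ) * (ms.count (EngelMove.type1 j) : ℚ))
    (p : Fin s → Fin s → ℚ)
    (hp : ∀ j i : Fin s, p j i = (rij j i : ℚ) / (ri j : ℚ))
    (vk : Fin s → ℚ)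
    (hvk : ∀ k : Fin s, vk k = ∑ j ∈ Finset.univ.filter (fun j : Fin s => (j : ℕ) < r),
      (ms.count (EngelMove.type1 j) : ℚ) * (rij j k : ℚ)) :
    (w u = v + ∑ j ∈ Finset.univ.filter (fun j : Fin s => (j : ℕ) < r), w j * p j u) ∧
    (∀ i : Fin s, (i : ℕ) < r → i ≠ u →
      w i = ∑ j ∈ Finset.univ.filter (fun j : Fin s => (j : ℕ) < r), w j * p j i) ∧
    (∀ k : Fin s, r ≤ (k : ℕ) →
      vk k = ∑ j ∈ Finset.univ.filter (fun j : Fin s => (j : ℕ) < r), w j * p j k) ∧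
    (v = ∑ k ∈ Finset.univ.filter (fun k : Fin s => r ≤ (k : ℕ)), vk k) := by
  have hflow (i j : Fin s) (hj : (j : ℕ) < r) :
      w j * p j i = (ms.count (EngelMove.type1 j) : ℚ) * (rij j i : ℚ) := by
    have : (ri j : ℚ) ≠ 0 := by exact_mod_cast (hri j hj).ne'
    rw [hw, hp]
    field_simp
  have hinflow (i : Fin s) :
      ∑ j ∈ Finset.univ.filter (fun j : Fin s => (j : ℕ) < r), w j * p j i = vk i := by
    rw [hvk]
    exact Finset.sum_congr rfl fun j hj => hflow i j (Finset.mem_filter.mp hj).2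
  have hbalance (i : Fin s) (hi : (i : ℕ) < r) : w i = (if i = u then v else 0) + vk i := by
    have h := engelRun_add_fired hlegal i
    rw [hsame i hi, add_assoc, Nat.add_left_cancel_iff] at h
    rw [hw, hv, hvk]
    exact_mod_cast h
  have htotal : ∑ k, vk k =
      ∑ j ∈ Finset.univ.filter (fun j : Fin s => (j : ℕ) < r), w j := by
    simp only [hvk]
    rw [Finset.sum_comm]
    refine Finset.sum_congr rfl fun j hj => ?_
    rw [← Finset.mul_sum, ← Nat.cast_sum, hsum j (Finset.mem_filter.mp hj).2, hw, mul_comm]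
  have htransient : ∑ j ∈ Finset.univ.filter (fun j : Fin s => (j : ℕ) < r), w j =
      v + ∑ j ∈ Finset.univ.filter (fun j : Fin s => (j : ℕ) < r), vk j := by
    rw [Finset.sum_congr rfl fun j hj => hbalance j (Finset.mem_filter.mp hj).2,
      Finset.sum_add_distrib]
    simp [Finset.sum_ite_eq', hu]
  refine ⟨?_, fun i hi hiu => ?_, fun k _ => (hinflow k).symm, ?_⟩
  · rw [hinflow, hbalance u hu, if_pos rfl]
  · rw [hinflow, hbalance i hi, if_neg hiu, zero_add]
  · have hsplit := Finset.sum_filter_add_sum_filter_not Finset.univ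
      (fun j : Fin s => (j : ℕ) < r) vk
    simp only [not_lt] at hsplit
    linarith
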